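/- arXiv:math/0208230 — 2 statements merged into one kernel-verified Lean document; each statement's English description precedes it below -/
import Mathlib

section
/- Let f: ℝ → ℝ be real and even, with Fourier transform f̂ continuous and supported in [−α, α] for some 0 < α ≤ 2. Then there is a constant C = C(f) such that for every odd prime q ≥ 3, |⟨W_f^osc⟩_q| ≤ C·q^{α/2−1}/log q. In particular, when supp f̂ ⊆ [−2,2] the character average ⟨W_f^osc⟩_q is O(1/log q) and tends to 0 as q → ∞ through primes. -/
open ArithmeticFunction Filter

/-- The oscillatory part of the linear statistic:
`W_f^osc(χ) = -(1/log q) ∑ₙ (Λ(n)/√n) f̂(log n/log q) (χ(n) + conj χ(n))`. -/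
noncomputable def Wosc (q : ℕ) (fhat : ℝ → ℝ) (χ : DirichletCharacter ℂ q) : ℝ :=
  -(1 / Real.log q) *
    ∑' n : ℕ, Λ n / Real.sqrt n * fhat (Real.log n / Real.log q) *
      (χ n + (starRingEnd ℂ) (χ n)).re

open scoped Classical in
/-- The average over the `q - 2` nontrivial Dirichlet characters modulo the prime `q`. -/
noncomputable def charAvg (q : ℕ) (H : DirichletCharacter ℂ q → ℝ) : ℝ :=
  (1 / (q - 2 : ℝ)) * ∑ χ ∈ Finset.univ.filter (fun χ : DirichletCharacter ℂ q => χ ≠ 1), H χ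

section Auxiliary

open Finset

/-- The Selberg-type sieve weight of level `z`. -/
noncomputable def sieveWeight (z g : ℕ) : ℝ :=
  g * ∑ d ∈ Icc 1 z with g ∣ d, (moebius d * moebius (d / g) : ℝ) / d

/-- The sum of the reciprocals of the squarefree integers up to `z`. -/
noncomputable def squarefreeSum (z : ℕ) : ℝ :=
  ∑ d ∈ Icc 1 z, (moebius d : ℝ) ^ 2 / d

theorem sum_divisors_moebius (e : ℕ) :
    ∑ i ∈ e.divisors, (moebius i : ℝ) = if e = 1 then 1 else 0 := by
  have h := congrArg (fun f : ArithmeticFunction ℤ => (f e : ℝ)) coe_zeta_mul_moebius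
  simp only [coe_zeta_mul_apply, one_apply] at h
  push_cast at h
  exact h

theorem sum_moebius_div_of_dvd {t d z : ℕ} (hd : d ∈ Icc 1 z) :
    ∑ g ∈ Icc 1 z with t ∣ g ∧ g ∣ d, (moebius (d / g) : ℝ) = if d = t then 1 else 0 := by
  simp only [mem_Icc] at hd
  by_cases htd : t ∣ d
  · obtain ⟨e, rfl⟩ := htd
    have he : 0 < e := by by_contra h; simp_all
    have ht : 0 < t := by by_contra h; simp_all
    have h1 : (t * e = t) ↔ e = 1 := by
      constructor
      · intro h; nlinarith
      · rintro rfl; simp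
    simp only [h1]
    rw [← sum_divisors_moebius]
    refine sum_bij' (fun g _ => t * e / g) (fun i _ => t * e / i) ?_ ?_ ?_ ?_ ?_
    · intro g hg
      simp only [mem_filter, mem_Icc] at hg
      obtain ⟨-, ⟨h, rfl⟩, hge⟩ := hg
      have : h ∣ e := Nat.dvd_of_mul_dvd_mul_left ht hge
      rw [Nat.mul_div_mul_left _ _ ht]
      simp only [Nat.mem_divisors]
      exact ⟨Nat.div_dvd_of_dvd this, he.ne'⟩
    · intro i hi
      simp only [Nat.mem_divisors] at hi
      obtain ⟨⟨j, rfl⟩, -⟩ := hi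
      have hi0 : 0 < i := by by_contra h; simp_all
      have hj0 : 0 < j := by by_contra h; simp_all
      have : t * (i * j) / i = t * j := by
        rw [show t * (i * j) = i * (t * j) by ring, Nat.mul_div_cancel_left _ hi0]
      simp only [mem_filter, mem_Icc, this]
      have h3 : t * j ∣ t * (i * j) := ⟨i, by ring⟩
      exact ⟨⟨Nat.mul_pos ht hj0, (Nat.le_of_dvd hd.1 h3).trans hd.2⟩, dvd_mul_right _ _, h3⟩
    · intro g hg
      simp only [mem_filter, mem_Icc] at hg
      exact Nat.div_div_self hg.2.2 (by omega)
    · intro i hi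
      simp only [Nat.mem_divisors] at hi
      exact Nat.div_div_self (hi.1.trans (dvd_mul_left _ _)) (by omega)
    · intro g hg
      rfl
  · rw [if_neg (by rintro rfl; simp at htd), filter_eq_empty_iff.2, sum_empty]
    rintro g - ⟨h1, h2⟩
    exact htd (h1.trans h2)

theorem sum_sieveWeight_div {z t : ℕ} (ht : t ∈ Icc 1 z) :
    ∑ g ∈ Icc 1 z with t ∣ g, sieveWeight z g / g = moebius t / t := by
  have h1 : ∀ g ∈ Icc 1 z, sieveWeight z g / g =
      ∑ d ∈ Icc 1 z with g ∣ d, (moebius d * moebius (d / g) : ℝ) / d := by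
    intro g hg
    have : (g : ℝ) ≠ 0 := by simp at hg; norm_cast; omega
    rw [sieveWeight]; field_simp
  rw [sum_congr rfl (fun g hg => h1 g (mem_filter.1 hg).1)]
  simp only [sum_filter]
  have h2 : ∀ g ∈ Icc 1 z, (if t ∣ g then ∑ d ∈ Icc 1 z,
      if g ∣ d then (moebius d * moebius (d / g) : ℝ) / d else 0 else 0) =
      ∑ d ∈ Icc 1 z, (moebius d : ℝ) / d *
        (if t ∣ g ∧ g ∣ d then (moebius (d / g) : ℝ) else 0) := by
    intro g _
    split_ifs with h
    · refine sum_congr rfl fun d _ => ?_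
      by_cases h' : g ∣ d <;> simp [h, h']; ring
    · simp [h]
  rw [sum_congr rfl h2, sum_comm]
  simp only [← mul_sum, ← sum_filter]
  rw [sum_congr rfl (fun d hd => by rw [sum_moebius_div_of_dvd hd])]
  simp [sum_ite_eq', ht]

theorem abs_sieveWeight_le {z g : ℕ} (hg : 0 < g) : |sieveWeight z g| ≤ z := by
  have hg' : (0 : ℝ) < g := by exact_mod_cast hg
  rw [sieveWeight, abs_mul, Nat.abs_cast]
  have hm : ∀ n, |(moebius n : ℝ)| ≤ 1 := fun n => by exact_mod_cast abs_moebius_le_one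
  calc (g : ℝ) * |∑ d ∈ Icc 1 z with g ∣ d, (moebius d * moebius (d / g) : ℝ) / d|
      ≤ g * ∑ d ∈ Icc 1 z with g ∣ d, 1 / (g : ℝ) := by
        gcongr
        refine (abs_sum_le_sum_abs _ _).trans (sum_le_sum fun d hd => ?_)
        simp only [mem_filter, mem_Icc] at hd
        rw [abs_div, abs_mul, Nat.abs_cast]
        have : g ≤ d := Nat.le_of_dvd hd.1.1 hd.2
        gcongr
        exact mul_le_one₀ (hm _) (abs_nonneg _) (hm _)
    _ ≤ g * ∑ d ∈ Icc 1 z, 1 / (g : ℝ) := by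
        gcongr
        exact filter_subset _ _
    _ = z := by simp; field_simp

theorem sieveWeight_one (z : ℕ) : sieveWeight z 1 = squarefreeSum z := by
  simp [sieveWeight, squarefreeSum, sq]

theorem sum_sieveWeight_quadratic_form_le (z : ℕ) :
    ∑ g ∈ Icc 1 z, ∑ h ∈ Icc 1 z, sieveWeight z g * sieveWeight z h / (g.lcm h : ℝ) ≤
      squarefreeSum z := by
  have key : ∀ g ∈ Icc 1 z, ∀ h ∈ Icc 1 z,
      sieveWeight z g * sieveWeight z h / (g.lcm h : ℝ) =
      ∑ t ∈ Icc 1 z, (t.totient : ℝ) * ((if t ∣ g then sieveWeight z g / g else 0) *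
        (if t ∣ h then sieveWeight z h / h else 0)) := by
    intro g hg h hh
    simp only [mem_Icc] at hg hh
    have hg0 : (g : ℝ) ≠ 0 := by norm_cast; omega
    have hh0 : (h : ℝ) ≠ 0 := by norm_cast; omega
    have hgcd : 0 < g.gcd h := Nat.gcd_pos_of_pos_left _ hg.1
    have h1 : ((g.gcd h : ℕ) : ℝ) = ∑ t ∈ Icc 1 z with t ∣ g ∧ t ∣ h, (t.totient : ℝ) := by
      rw [← Nat.sum_totient (g.gcd h)]
      push_cast
      refine sum_congr ?_ fun _ _ => rfl
      ext t
      simp only [Nat.mem_divisors, mem_filter, mem_Icc, Nat.dvd_gcd_iff]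
      constructor
      · rintro ⟨⟨a, b⟩, -⟩
        exact ⟨⟨Nat.pos_of_dvd_of_pos a hg.1, (Nat.le_of_dvd hg.1 a).trans hg.2⟩, a, b⟩
      · rintro ⟨-, a⟩
        exact ⟨a, hgcd.ne'⟩
    have h2 : (g.gcd h : ℝ) * (g.lcm h : ℝ) = g * h := by exact_mod_cast Nat.gcd_mul_lcm g h
    have h3 : (g.lcm h : ℝ) ≠ 0 := by
      exact_mod_cast Nat.lcm_ne_zero (by omega) (by omega)
    have h4 : sieveWeight z g * sieveWeight z h / (g.lcm h : ℝ) =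
        (g.gcd h : ℝ) * (sieveWeight z g / g * (sieveWeight z h / h)) := by
      field_simp
      rw [mul_assoc, mul_assoc, ← h2]; ring
    rw [h4, h1, sum_mul, sum_filter]
    refine sum_congr rfl fun t _ => ?_
    by_cases a : t ∣ g <;> by_cases b : t ∣ h <;> simp [a, b]
  calc _ = ∑ t ∈ Icc 1 z, (t.totient : ℝ) *
        (∑ g ∈ Icc 1 z with t ∣ g, sieveWeight z g / g) ^ 2 := by
        rw [sum_congr rfl fun g hg => sum_congr rfl fun h hh => key g hg h hh]
        rw [sum_congr rfl fun g _ => sum_comm, sum_comm]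
        refine sum_congr rfl fun t _ => ?_
        simp only [← mul_sum, sum_filter, sq, sum_mul_sum]
    _ ≤ _ := by
        refine sum_le_sum fun t ht => ?_
        rw [sum_sieveWeight_div ht]
        simp only [mem_Icc] at ht
        have ht0 : (0 : ℝ) < t := by norm_cast; omega
        have : (t.totient : ℝ) ≤ t := by exact_mod_cast Nat.totient_le t
        calc (t.totient : ℝ) * (moebius t / t) ^ 2 ≤ t * (moebius t / t) ^ 2 := by gcongr
          _ = _ := by field_simp

theorem log_le_two_mul_squarefreeSum (z : ℕ) :
    Real.log (z + 1) ≤ 2 * squarefreeSum z := by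
  have h1 : Real.log (z + 1) ≤ ∑ n ∈ Icc 1 z, (1 : ℝ) / n := by
    have := log_add_one_le_harmonic z
    rw [harmonic_eq_sum_Icc] at this
    push_cast at this
    simpa using this
  have hS : squarefreeSum z = ∑ d ∈ Icc 1 z with Squarefree d, (1 : ℝ) / d := by
    rw [squarefreeSum, sum_filter]
    refine sum_congr rfl fun d _ => ?_
    have : ((moebius d : ℝ)) ^ 2 = if Squarefree d then 1 else 0 := by
      exact_mod_cast (moebius_sq (n := d))
    rw [this]; split_ifs <;> simp
  have h2 : ∑ b ∈ Icc 1 z, (1 : ℝ) / (b : ℝ) ^ 2 ≤ 2 := by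
    have := sum_Ioo_inv_sq_le (α := ℝ) 0 (z + 1)
    simpa [← one_div, show Ioo 0 (z + 1) = Icc 1 z by ext; simp; omega] using this
  choose A B hAB hA using Nat.sq_mul_squarefree
  have h3 : ∑ n ∈ Icc 1 z, (1 : ℝ) / n ≤
      ∑ p ∈ (Icc 1 z) ×ˢ (Icc 1 z).filter Squarefree, 1 / (p.1 : ℝ) ^ 2 * (1 / (p.2 : ℝ)) := by
    have hinj : Set.InjOn (fun n => (B n, A n)) (Icc 1 z : Finset ℕ) := by
      intro a _ b _ hab
      simp only [Prod.mk.injEq] at hab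
      rw [← hAB a, ← hAB b, hab.1, hab.2]
    calc ∑ n ∈ Icc 1 z, (1 : ℝ) / n
        = ∑ p ∈ (Icc 1 z).image (fun n => (B n, A n)), 1 / (p.1 : ℝ) ^ 2 * (1 / (p.2 : ℝ)) := by
          rw [sum_image hinj]
          refine sum_congr rfl fun n _ => ?_
          conv_lhs => rw [← hAB n]
          push_cast
          ring
      _ ≤ _ := by
          refine sum_le_sum_of_subset_of_nonneg ?_ fun _ _ _ => by positivity
          intro p hp
          simp only [mem_image, mem_Icc] at hp
          obtain ⟨n, hn, rfl⟩ := hp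
          have e := hAB n
          have hb : 0 < B n := by
            by_contra h
            simp only [not_lt, nonpos_iff_eq_zero] at h
            rw [h] at e; simp at e; omega
          have ha : 0 < A n := by
            by_contra h
            simp only [not_lt, nonpos_iff_eq_zero] at h
            rw [h] at e; simp at e; omega
          have hb2 : B n ≤ B n ^ 2 := Nat.le_self_pow (by norm_num) _
          simp only [mem_product, mem_filter, mem_Icc]
          refine ⟨⟨hb, ?_⟩, ⟨ha, ?_⟩, hA n⟩ <;> nlinarith
  rw [sum_product] at h3
  simp only [← sum_mul_sum, ← hS] at h3
  have h0 : 0 ≤ squarefreeSum z := sum_nonneg fun _ _ => by positivity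
  nlinarith

theorem card_filter_dvd_progression {m q : ℕ} (hm : 0 < m) (hq : m.Coprime q) (N : ℕ) :
    |(#{j ∈ range N | m ∣ (j + 1) * q + 1} : ℝ) - N / m| ≤ 1 := by
  obtain ⟨r, hr⟩ : ∃ r : ℕ, m ∣ (r + 1) * q + 1 := by
    have : NeZero m := ⟨hm.ne'⟩
    refine ⟨(-(q : ZMod m)⁻¹ - 1).val, ?_⟩
    rw [← ZMod.natCast_eq_zero_iff]
    push_cast
    rw [ZMod.natCast_val, ZMod.cast_id]
    have : (q : ZMod m) * (q : ZMod m)⁻¹ = 1 := ZMod.coe_mul_inv_eq_one q hq.symm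
    linear_combination -this
  have hiff : ∀ j : ℕ, m ∣ (j + 1) * q + 1 ↔ j ≡ r [MOD m] := by
    intro j
    have hr' := (Nat.modEq_zero_iff_dvd.2 hr)
    rw [← Nat.modEq_zero_iff_dvd]
    constructor
    · intro h
      exact ((((h.trans hr'.symm).add_right_cancel' 1).cancel_right_of_coprime hq)).add_right_cancel' 1
    · intro h
      exact (((h.add_right 1).mul_right q).add_right 1).trans hr'
  have hcard : #{j ∈ range N | m ∣ (j + 1) * q + 1} = N.count (· ≡ r [MOD m]) := by
    rw [Nat.count_eq_card_filter_range]
    simp only [hiff]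
  rw [hcard, Nat.count_modEq_card _ hm]
  have hm' : (0 : ℝ) < m := by exact_mod_cast hm
  have h1 : ((N / m : ℕ) : ℝ) ≤ N / m := Nat.cast_div_le
  have h2 : (N : ℝ) / m < (N / m : ℕ) + 1 := by
    rw [div_lt_iff₀ hm']
    exact_mod_cast (by rw [mul_comm]; exact Nat.lt_mul_div_succ N hm : N < (N / m + 1) * m)
  push_cast
  rw [abs_le]
  split_ifs <;> constructor <;> simp <;> linarith

/-- Selberg's upper bound sieve for the progression `1 mod q`. -/
theorem card_sifted_mul_sq_le {z q : ℕ} (hz : 1 ≤ z) (hq : ∀ g ∈ Icc 1 z, g.Coprime q) (N : ℕ) :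
    (#{j ∈ range N | ∀ g ∈ Icc 2 z, ¬ g ∣ (j + 1) * q + 1} : ℝ) * squarefreeSum z ^ 2 ≤
      N * squarefreeSum z + z ^ 4 := by
  set A := (range N).filter fun j => ∀ g ∈ Icc 2 z, ¬ g ∣ (j + 1) * q + 1
  set F : ℕ → ℝ := fun n => ∑ g ∈ Icc 1 z, if g ∣ n then sieveWeight z g else 0 with hF
  have hA : ∀ j ∈ A, F ((j + 1) * q + 1) = squarefreeSum z := by
    intro j hj
    rw [hF, ← sieveWeight_one]
    simp only
    rw [sum_eq_single_of_mem 1 (by simp; omega)]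
    · simp
    · intro g hg hg1
      rw [if_neg]
      refine (mem_filter.1 hj).2 g ?_
      simp only [mem_Icc] at hg ⊢
      omega
  have hcop : ∀ g ∈ Icc 1 z, ∀ h ∈ Icc 1 z, (g.lcm h).Coprime q := by
    intro g hg h hh
    exact Nat.Coprime.of_dvd_left (Nat.lcm_dvd_mul g h) (Nat.Coprime.mul_left (hq g hg) (hq h hh))
  calc (#A : ℝ) * squarefreeSum z ^ 2 = ∑ j ∈ A, F ((j + 1) * q + 1) ^ 2 := by
        rw [sum_congr rfl fun j hj => by rw [hA j hj]]
        simp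
    _ ≤ ∑ j ∈ range N, F ((j + 1) * q + 1) ^ 2 :=
        sum_le_sum_of_subset_of_nonneg (filter_subset _ _) fun _ _ _ => sq_nonneg _
    _ = ∑ g ∈ Icc 1 z, ∑ h ∈ Icc 1 z, sieveWeight z g * sieveWeight z h *
          (#{j ∈ range N | g.lcm h ∣ (j + 1) * q + 1} : ℝ) := by
        simp only [hF, sq, sum_mul_sum]
        rw [sum_comm]
        refine sum_congr rfl fun g _ => ?_
        rw [sum_comm]
        refine sum_congr rfl fun h _ => ?_
        rw [← sum_boole, mul_sum]
        refine sum_congr rfl fun j _ => ?_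
        simp only [Nat.lcm_dvd_iff]
        split_ifs <;> simp_all
    _ ≤ ∑ g ∈ Icc 1 z, ∑ h ∈ Icc 1 z,
          (N * (sieveWeight z g * sieveWeight z h / (g.lcm h : ℝ)) + (z : ℝ) ^ 2) := by
        refine sum_le_sum fun g hg => sum_le_sum fun h hh => ?_
        have hg1 := (mem_Icc.1 hg).1
        have hh1 := (mem_Icc.1 hh).1
        have hc := card_filter_dvd_progression (Nat.lcm_pos hg1 hh1) (hcop g hg h hh) N
        set c : ℝ := (#{j ∈ range N | g.lcm h ∣ (j + 1) * q + 1} : ℝ)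
        have e : sieveWeight z g * sieveWeight z h * c =
            N * (sieveWeight z g * sieveWeight z h / (g.lcm h : ℝ)) +
            sieveWeight z g * sieveWeight z h * (c - N / (g.lcm h : ℝ)) := by ring
        rw [e]
        gcongr
        refine (le_abs_self _).trans ?_
        rw [abs_mul, abs_mul, sq]
        calc _ ≤ (z : ℝ) * z * 1 := by
              gcongr
              · exact abs_sieveWeight_le hg1
              · exact abs_sieveWeight_le hh1
          _ = _ := by ring
    _ = N * ∑ g ∈ Icc 1 z, ∑ h ∈ Icc 1 z,
          sieveWeight z g * sieveWeight z h / (g.lcm h : ℝ) + z ^ 4 := by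
        simp only [sum_add_distrib, ← mul_sum]
        simp
        ring
    _ ≤ _ := by
        gcongr
        exact sum_sieveWeight_quadratic_form_le z

theorem sum_mul_le_of_antitone {a w : ℕ → ℝ} {E : ℝ} (hw : Antitone w) (hw0 : ∀ n, 0 ≤ w n)
    (ha : ∀ n, ∑ k ∈ range n, a k ≤ E) (n : ℕ) : ∑ k ∈ range n, a k * w k ≤ E * w 0 := by
  rcases n with _ | n
  · have := ha 0
    simp at this ⊢
    exact mul_nonneg this (hw0 0)
  have key : ∑ k ∈ range (n + 1), a k * w k ≤
      w n * ∑ k ∈ range (n + 1), a k + E * (w 0 - w n) := by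
    induction n with
    | zero => simp [mul_comm]
    | succ n ih =>
      rw [sum_range_succ, sum_range_succ _ (n + 1)]
      have := mul_le_mul_of_nonneg_left (ha (n + 1)) (sub_nonneg.2 (hw (Nat.le_succ n)))
      linarith
  have := mul_le_mul_of_nonneg_left (ha (n + 1)) (hw0 n)
  linarith

theorem sum_range_inv_sqrt_le (n : ℕ) :
    ∑ k ∈ range n, 1 / √((k : ℝ) + 1) ≤ 2 * √n := by
  induction n with
  | zero => simp
  | succ n ih =>
    rw [sum_range_succ]
    push_cast
    have h0 : 0 < √((n : ℝ) + 1) := Real.sqrt_pos.2 (by positivity)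
    have h1 := Real.sq_sqrt (show (0 : ℝ) ≤ n by positivity)
    have h2 := Real.sq_sqrt (show (0 : ℝ) ≤ (n : ℝ) + 1 by positivity)
    have : 1 / √((n : ℝ) + 1) ≤ 2 * √((n : ℝ) + 1) - 2 * √n := by
      rw [div_le_iff₀ h0]
      nlinarith [sq_nonneg (√((n : ℝ) + 1) - √n)]
    linarith

theorem antitone_inv_sqrt_add_one : Antitone fun k : ℕ => 1 / √((k : ℝ) + 1) := by
  intro a b hab
  have : (a : ℝ) ≤ b := by exact_mod_cast hab
  exact one_div_le_one_div_of_le (Real.sqrt_pos.2 (by positivity))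
    (Real.sqrt_le_sqrt (by linarith))

theorem sum_vonMangoldt_div_sqrt_le (N : ℕ) :
    ∑ n ∈ range (N + 1), Λ n / √(n : ℝ) ≤ 2 * (Real.log 4 + 4) * √N := by
  have h := sum_mul_le_of_antitone (a := fun k => Λ (k + 1) - (Real.log 4 + 4)) (E := 0)
    antitone_inv_sqrt_add_one (fun _ => by positivity) (fun n => ?_) N
  · simp only [sub_mul, sum_sub_distrib, ← mul_sum, zero_mul] at h
    rw [sum_range_succ']
    simp only [ArithmeticFunction.map_zero, zero_div, add_zero]
    have h2 := sum_range_inv_sqrt_le N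
    have h3 : 0 ≤ Real.log 4 := Real.log_nonneg (by norm_num)
    have h4 : (Real.log 4 + 4) * ∑ k ∈ range N, 1 / √((k : ℝ) + 1) ≤
      (Real.log 4 + 4) * (2 * √N) := by gcongr
    have h5 : ∑ k ∈ range N, Λ (k + 1) / √((k + 1 : ℕ) : ℝ) =
        ∑ k ∈ range N, Λ (k + 1) * (1 / √((k : ℝ) + 1)) :=
      sum_congr rfl fun k _ => by push_cast; ring
    rw [h5]
    linarith
  · have := Chebyshev.psi_le_const_mul_self (x := (n : ℝ)) (by positivity)
    rw [Chebyshev.psi, Nat.floor_natCast] at this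
    have e : ∑ k ∈ range n, Λ (k + 1) = ∑ k ∈ Ioc 0 n, Λ k := by
      rw [range_eq_Ico, sum_Ico_add' (fun k => Λ k) 0 n 1]
      refine sum_congr ?_ fun _ _ => rfl
      ext; simp; omega
    rw [sum_sub_distrib, e]
    simp
    linarith

theorem sum_sifted_inv_sqrt_le {z q : ℕ} (hz : 1 ≤ z) (hq : ∀ g ∈ Icc 1 z, g.Coprime q) (N : ℕ) :
    ∑ j ∈ range N with ∀ g ∈ Icc 2 z, ¬ g ∣ (j + 1) * q + 1, 1 / √((j : ℝ) + 1) ≤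
      2 / squarefreeSum z * √N + z ^ 4 / squarefreeSum z ^ 2 := by
  have hS : 0 < squarefreeSum z := by
    have := log_le_two_mul_squarefreeSum z
    have : 0 < Real.log ((z : ℝ) + 1) := Real.log_pos (by
      have : (1 : ℝ) ≤ z := by exact_mod_cast hz
      linarith)
    linarith
  have h := sum_mul_le_of_antitone (E := (z : ℝ) ^ 4 / squarefreeSum z ^ 2)
    (a := fun j => (if ∀ g ∈ Icc 2 z, ¬ g ∣ (j + 1) * q + 1 then 1 else 0) - 1 / squarefreeSum z)
    antitone_inv_sqrt_add_one (fun _ => by positivity) (fun n => ?_) N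
  · simp only [sub_mul, sum_sub_distrib, ← mul_sum, ite_mul, one_mul, zero_mul] at h
    rw [← sum_filter] at h
    have h2 := mul_le_mul_of_nonneg_left (sum_range_inv_sqrt_le N) (one_div_pos.2 hS).le
    have e : 2 / squarefreeSum z * √N = 1 / squarefreeSum z * (2 * √N) := by ring
    simp only [Nat.cast_zero, zero_add, Real.sqrt_one, div_one, mul_one] at h
    rw [e]
    linarith
  · have := card_sifted_mul_sq_le hz hq n
    rw [sum_sub_distrib, sum_boole, sum_const, card_range, nsmul_eq_mul, sub_le_iff_le_add]
    rw [← le_div_iff₀ (by positivity)] at this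
    refine this.trans (le_of_eq ?_)
    field_simp
    ring

theorem card_primePow_small_factor_le {z q N : ℕ} (hq : 0 < q) (J : Finset ℕ)
    (hJ : ∀ j ∈ J, (j + 1) * q + 1 ≤ N ∧ IsPrimePow ((j + 1) * q + 1) ∧
      ∃ g ∈ Icc 2 z, g ∣ (j + 1) * q + 1) :
    #J ≤ (z + 1) * (Nat.log 2 N + 1) := by
  have hinj : Set.InjOn (fun j => (j + 1) * q + 1) (J : Set ℕ) := by
    intro a _ b _ hab
    simp only [add_left_inj] at hab
    have := Nat.eq_of_mul_eq_mul_right hq hab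
    omega
  rw [← card_image_of_injOn hinj]
  refine (card_le_card (t := (range (z + 1) ×ˢ range (Nat.log 2 N + 1)).image
    fun p => p.1 ^ p.2) ?_).trans (card_image_le.trans (by simp))
  intro n hn
  simp only [mem_image] at hn
  obtain ⟨j, hj, rfl⟩ := hn
  obtain ⟨hle, hpp, g, hg, hgn⟩ := hJ j hj
  obtain ⟨p, m, hp, hm, hpm⟩ := (isPrimePow_nat_iff _).1 hpp
  simp only [mem_image, mem_product, mem_range, Prod.exists]
  refine ⟨p, m, ⟨?_, ?_⟩, hpm⟩
  · simp only [mem_Icc] at hg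
    rw [← hpm] at hgn
    obtain ⟨k, -, rfl⟩ := (Nat.dvd_prime_pow hp).1 hgn
    have : k ≠ 0 := by rintro rfl; simp at hg
    have := Nat.le_self_pow this p
    omega
  · have h1 : 2 ^ m ≤ N := (Nat.pow_le_pow_left hp.two_le m).trans (hpm.trans_le hle)
    have := Nat.le_log_of_pow_le (by norm_num) h1
    omega

theorem sum_vonMangoldt_progression_le {q z N K : ℕ} (hq : q.Prime) (hz : 1 ≤ z) (hzq : z < q)
    (hK : N ≤ (K + 1) * q) :
    ∑ n ∈ range (N + 1) with n ≡ 1 [MOD q], Λ n / √(n : ℝ) ≤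
      Real.log N / √(q : ℝ) * (2 / squarefreeSum z * √K + z ^ 4 / squarefreeSum z ^ 2 +
        (z + 1) * (Nat.log 2 N + 1)) := by
  have hq0 : (0 : ℝ) < q := by exact_mod_cast hq.pos
  have hcop : ∀ g ∈ Icc 1 z, g.Coprime q := by
    intro g hg
    simp only [mem_Icc] at hg
    exact (Nat.coprime_of_lt_prime (by omega) (by omega) hq).symm
  set J := (range K).filter fun j => (j + 1) * q + 1 ≤ N ∧ IsPrimePow ((j + 1) * q + 1)
  set A := (range K).filter fun j => ∀ g ∈ Icc 2 z, ¬ g ∣ (j + 1) * q + 1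
  set B := J.filter fun j => ∃ g ∈ Icc 2 z, g ∣ (j + 1) * q + 1
  have hlogN : 0 ≤ Real.log N := Real.log_natCast_nonneg N
  have hinj : Set.InjOn (fun j => (j + 1) * q + 1) (J : Set ℕ) := by
    intro a _ b _ hab
    simp only [add_left_inj] at hab
    have := Nat.eq_of_mul_eq_mul_right hq.pos hab
    omega
  have hB : (#B : ℝ) ≤ (z + 1) * (Nat.log 2 N + 1) := by
    have := card_primePow_small_factor_le (z := z) (N := N) hq.pos B (fun j hj => by
      obtain ⟨h1, h2⟩ := mem_filter.1 hj
      obtain ⟨-, h3, h4⟩ := mem_filter.1 h1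
      exact ⟨h3, h4, h2⟩)
    exact_mod_cast this
  calc ∑ n ∈ range (N + 1) with n ≡ 1 [MOD q], Λ n / √(n : ℝ)
      = ∑ n ∈ (range (N + 1)).filter (fun n : ℕ => n ≡ 1 [MOD q]) with IsPrimePow n,
          Λ n / √(n : ℝ) := by
        rw [sum_filter IsPrimePow]
        refine sum_congr rfl fun n _ => ?_
        split_ifs with h
        · rfl
        · rw [not_ne_iff.1 (mt vonMangoldt_ne_zero_iff.1 h), zero_div]
    _ ≤ ∑ n ∈ J.image (fun j => (j + 1) * q + 1), Λ n / √(n : ℝ) := by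
        refine sum_le_sum_of_subset_of_nonneg ?_
          fun _ _ _ => div_nonneg vonMangoldt_nonneg (Real.sqrt_nonneg _)
        intro n hn
        simp only [mem_filter, mem_range] at hn
        obtain ⟨⟨hnN, hn1⟩, hpp⟩ := hn
        have h1 : 1 < n := hpp.one_lt
        have hdvd : q ∣ n - 1 := (Nat.modEq_iff_dvd' h1.le).1 hn1.symm
        obtain ⟨k, hk⟩ := hdvd
        obtain ⟨j, rfl⟩ : ∃ j, k = j + 1 := by
          refine Nat.exists_eq_add_one_of_ne_zero ?_
          rintro rfl
          omega
        have hn' : (j + 1) * q + 1 = n := by rw [mul_comm]; omega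
        simp only [mem_image]
        refine ⟨j, mem_filter.2 ⟨mem_range.2 ?_, by omega, hn' ▸ hpp⟩, hn'⟩
        by_contra hjK
        have : (K + 1) * q ≤ (j + 1) * q := Nat.mul_le_mul_right _ (by omega)
        omega
    _ = ∑ j ∈ J, Λ ((j + 1) * q + 1) / √(((j + 1) * q + 1 : ℕ) : ℝ) := sum_image hinj
    _ ≤ ∑ j ∈ J, Real.log N / √(q : ℝ) * (1 / √((j : ℝ) + 1)) := by
        refine sum_le_sum fun j hj => ?_
        obtain ⟨-, hjN, -⟩ := mem_filter.1 hj
        rw [div_mul_div_comm, mul_one, ← Real.sqrt_mul hq0.le]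
        refine div_le_div₀ hlogN (vonMangoldt_le_log.trans ?_)
          (Real.sqrt_pos.2 (by positivity)) (Real.sqrt_le_sqrt ?_)
        · exact Real.log_le_log (by positivity) (by exact_mod_cast hjN)
        · push_cast
          linarith
    _ = Real.log N / √(q : ℝ) * ∑ j ∈ J, 1 / √((j : ℝ) + 1) := by rw [mul_sum]
    _ ≤ Real.log N / √(q : ℝ) * (∑ j ∈ A, 1 / √((j : ℝ) + 1) + ∑ j ∈ B, 1 / √((j : ℝ) + 1)) := by
        gcongr
        rw [← sum_filter_not_add_sum_filter J (fun j => ∃ g ∈ Icc 2 z, g ∣ (j + 1) * q + 1)]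
        gcongr
        intro j hj
        obtain ⟨h1, h2⟩ := mem_filter.1 hj
        push Not at h2
        exact mem_filter.2 ⟨(mem_filter.1 h1).1, h2⟩
    _ ≤ _ := by
        gcongr
        · exact sum_sifted_inv_sqrt_le hz hcop K
        · refine le_trans (sum_le_card_nsmul B _ 1 fun j _ => ?_) (by simpa using hB)
          rw [div_le_one (Real.sqrt_pos.2 (by positivity)), Real.one_le_sqrt]
          linarith [(Nat.cast_nonneg j : (0 : ℝ) ≤ j)]

theorem one_le_log_natCast {q : ℕ} (hq : 3 ≤ q) : 1 ≤ Real.log q := by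
  rw [Real.le_log_iff_exp_le (by positivity)]
  have : (3 : ℝ) ≤ q := by exact_mod_cast hq
  linarith [Real.exp_one_lt_d9]

/-- A weighted Brun-Titchmarsh bound for the progression `1 mod q` up to `q ^ α`. -/
theorem sum_vonMangoldt_progression_floor_le {α : ℝ} (hα : 1 < α) (hα2 : α ≤ 2) {q : ℕ}
    (hq : q.Prime) (hq3 : 3 ≤ q) :
    ∑ n ∈ range (⌊(q : ℝ) ^ α⌋₊ + 1) with n ≡ 1 [MOD q], Λ n / √(n : ℝ) ≤
      (8 / ((α - 1) / 8) + 28 / ((α - 1) / 8) ^ 2) * (q : ℝ) ^ (α / 2 - 1) := by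
  set δ := (α - 1) / 8 with hδ
  have hδ0 : 0 < δ := by rw [hδ]; linarith
  have hδ1 : δ < 1 := by rw [hδ]; linarith
  have hq0 : (0 : ℝ) < q := by positivity
  have hq1 : (1 : ℝ) < q := by exact_mod_cast (by omega : 1 < q)
  set L := Real.log q with hL
  have hL1 : 1 ≤ L := one_le_log_natCast hq3
  set z := ⌊(q : ℝ) ^ δ⌋₊
  set N := ⌊(q : ℝ) ^ α⌋₊
  set K := ⌊(q : ℝ) ^ (α - 1)⌋₊
  have hzle : (z : ℝ) ≤ (q : ℝ) ^ δ := Nat.floor_le (by positivity)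
  have hNle : (N : ℝ) ≤ (q : ℝ) ^ α := Nat.floor_le (by positivity)
  have hKle : (K : ℝ) ≤ (q : ℝ) ^ (α - 1) := Nat.floor_le (by positivity)
  have hz1 : 1 ≤ z := Nat.le_floor (by simpa using Real.one_le_rpow hq1.le hδ0.le)
  have hN1 : 1 ≤ N := Nat.le_floor (by simpa using Real.one_le_rpow hq1.le (by linarith))
  have hzq : z < q := by
    have : (q : ℝ) ^ δ < q := by simpa using Real.rpow_lt_rpow_of_exponent_lt hq1 hδ1
    exact_mod_cast hzle.trans_lt this
  have hK : N ≤ (K + 1) * q := by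
    have h1 : (q : ℝ) ^ (α - 1) ≤ K + 1 := (Nat.lt_floor_add_one _).le
    have h2 : (q : ℝ) ^ α = (q : ℝ) ^ (α - 1) * q := by
      rw [← Real.rpow_add_one hq0.ne']; simp
    have : (N : ℝ) ≤ (K + 1) * q := by
      rw [h2] at hNle
      exact hNle.trans (by gcongr)
    exact_mod_cast this
  have hmain := sum_vonMangoldt_progression_le hq hz1 hzq hK
  have hS : δ * L / 2 ≤ squarefreeSum z := by
    have h1 := log_le_two_mul_squarefreeSum z
    have h2 : δ * L ≤ Real.log (z + 1) := by
      rw [hL, ← Real.log_rpow hq0]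
      exact Real.log_le_log (by positivity) (Nat.lt_floor_add_one _).le
    linarith
  have hlogN : Real.log N ≤ 2 * L := by
    calc Real.log N ≤ Real.log ((q : ℝ) ^ α) := Real.log_le_log (by exact_mod_cast hN1) hNle
      _ = α * L := Real.log_rpow hq0 _
      _ ≤ 2 * L := by gcongr
  have hlog2N : (Nat.log 2 N : ℝ) + 1 ≤ 5 * L := by
    have h1 : ((2 : ℝ)) ^ (Nat.log 2 N) ≤ N := by exact_mod_cast Nat.pow_log_le_self 2 (by omega)
    have h2 := Real.log_le_log (by positivity) h1
    rw [Real.log_pow] at h2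
    have h3 := Real.log_two_gt_d9
    have h4 : (0 : ℝ) ≤ Nat.log 2 N := Nat.cast_nonneg _
    nlinarith
  have hqδ : 1 ≤ (q : ℝ) ^ δ := Real.one_le_rpow hq1.le hδ0.le
  have hLδ : L ≤ (q : ℝ) ^ δ / δ := Real.log_le_rpow_div hq0.le hδ0
  set x := (q : ℝ) ^ δ
  have hx4 : (q : ℝ) ^ ((α - 1) / 2) = x ^ 4 := by
    rw [← Real.rpow_mul_natCast hq0.le]
    congr 1
    rw [hδ]; push_cast; ring
  have hsqrtK : √(K : ℝ) ≤ x ^ 4 := by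
    rw [← hx4]
    calc √(K : ℝ) ≤ √((q : ℝ) ^ (α - 1)) := Real.sqrt_le_sqrt hKle
      _ = _ := by rw [Real.sqrt_eq_rpow, ← Real.rpow_mul hq0.le]; congr 1; ring
  have hfin : x ^ 4 / √(q : ℝ) = (q : ℝ) ^ (α / 2 - 1) := by
    rw [← hx4, Real.sqrt_eq_rpow, ← Real.rpow_sub hq0]
    congr 1; ring
  refine hmain.trans ?_
  calc _ ≤ 2 * L / √(q : ℝ) * (2 / (δ * L / 2) * x ^ 4 + x ^ 4 / (δ * L / 2) ^ 2 +
        (x + x) * (5 * L)) := by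
        have : 0 < squarefreeSum z := lt_of_lt_of_le (by positivity) hS
        gcongr
    _ = (8 / δ + 8 / δ ^ 2 / L) * (x ^ 4 / √(q : ℝ)) + 20 * (x * L ^ 2) / √(q : ℝ) := by
        field_simp
        ring
    _ ≤ (8 / δ + 8 / δ ^ 2) * (x ^ 4 / √(q : ℝ)) + 20 * (x ^ 2 * (x / δ) ^ 2) / √(q : ℝ) := by
        have h1 : 8 / δ ^ 2 / L ≤ 8 / δ ^ 2 := div_le_self (by positivity) hL1
        have h2 : x ≤ x ^ 2 := by nlinarith
        gcongr
    _ = _ := by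
        rw [← hfin]
        field_simp
        ring

theorem charSum_re_nontrivial_abs_le {q : ℕ} [Fact q.Prime] (n : ℕ) :
    |∑ χ : DirichletCharacter ℂ q with χ ≠ 1, (χ n + (starRingEnd ℂ) (χ n)).re| ≤
      2 * (if n ≡ 1 [MOD q] then ((q : ℝ) - 1) else 0) + 2 := by
  classical
  have hp := Fact.out (p := q.Prime)
  have h1 : ∑ χ : DirichletCharacter ℂ q, χ n =
      if (n : ZMod q) = 1 then (q.totient : ℂ) else 0 := by
    convert DirichletCharacter.sum_characters_eq ℂ (n : ZMod q)
  have h2 : ∑ χ : DirichletCharacter ℂ q with χ ≠ 1, (χ n + (starRingEnd ℂ) (χ n)).re =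
      2 * (∑ χ : DirichletCharacter ℂ q, χ n).re -
        2 * ((1 : DirichletCharacter ℂ q) (n : ZMod q)).re := by
    rw [filter_ne', ← add_sum_erase univ _ (mem_univ (1 : DirichletCharacter ℂ q)),
      Complex.add_re, Complex.re_sum, mul_add, mul_sum]
    rw [add_sub_cancel_left]
    refine sum_congr rfl fun χ _ => ?_
    simp
    ring
  have h3 : |((1 : DirichletCharacter ℂ q) (n : ZMod q)).re| ≤ 1 :=
    (Complex.abs_re_le_norm _).trans (DirichletCharacter.norm_le_one _ _)
  have h4 : (∑ χ : DirichletCharacter ℂ q, χ n).re =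
      if n ≡ 1 [MOD q] then ((q : ℝ) - 1) else 0 := by
    have h0 : (n : ZMod q) = 1 ↔ n ≡ 1 [MOD q] := by
      rw [← ZMod.natCast_eq_natCast_iff, Nat.cast_one]
    simp only [h1, h0]
    rw [Nat.totient_prime hp]
    split_ifs
    · simp [Nat.cast_sub hp.one_le]
    · simp
  rw [h2, h4]
  have h5 : (0 : ℝ) ≤ if n ≡ 1 [MOD q] then ((q : ℝ) - 1) else 0 := by
    have : (1 : ℝ) ≤ q := by exact_mod_cast hp.one_le
    split_ifs <;> linarith
  rw [abs_le] at h3 ⊢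
  constructor <;> linarith

theorem Wosc_eq_sum {fhat : ℝ → ℝ} {α : ℝ} (hsupp : Function.support fhat ⊆ Set.Icc (-α) α)
    {q : ℕ} (hq3 : 3 ≤ q) (χ : DirichletCharacter ℂ q) :
    Wosc q fhat χ = -(1 / Real.log q) * ∑ n ∈ range (⌊(q : ℝ) ^ α⌋₊ + 1),
      Λ n / √(n : ℝ) * fhat (Real.log n / Real.log q) * (χ n + (starRingEnd ℂ) (χ n)).re := by
  rw [Wosc, tsum_eq_sum]
  intro n hn
  have hq0 : (0 : ℝ) < q := by positivity
  have hL := one_le_log_natCast hq3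
  rw [mem_range, not_lt, Nat.succ_le_iff, Nat.floor_lt (by positivity)] at hn
  have h1 : α * Real.log q < Real.log n := by
    rw [← Real.log_rpow hq0]
    exact Real.log_lt_log (by positivity) hn
  have h2 : fhat (Real.log n / Real.log q) = 0 := by
    by_contra h
    have := (hsupp h).2
    rw [div_le_iff₀ (by linarith)] at this
    linarith
  rw [h2]; simp

theorem abs_charAvg_Wosc_le {fhat : ℝ → ℝ} {α M : ℝ}
    (hsupp : Function.support fhat ⊆ Set.Icc (-α) α) (hM : ∀ u, |fhat u| ≤ M)
    {q : ℕ} (hq : q.Prime) (hq3 : 3 ≤ q) :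
    |charAvg q (Wosc q fhat)| ≤ M * (4 *
      ∑ n ∈ range (⌊(q : ℝ) ^ α⌋₊ + 1) with n ≡ 1 [MOD q], Λ n / √(n : ℝ) +
      6 / q * ∑ n ∈ range (⌊(q : ℝ) ^ α⌋₊ + 1), Λ n / √(n : ℝ)) / Real.log q := by
  classical
  have : Fact q.Prime := ⟨hq⟩
  have hq3' : (3 : ℝ) ≤ q := by exact_mod_cast hq3
  have hL := one_le_log_natCast hq3
  have hM0 : 0 ≤ M := (abs_nonneg _).trans (hM 0)
  set R := range (⌊(q : ℝ) ^ α⌋₊ + 1)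
  have hΛ : ∀ n : ℕ, 0 ≤ Λ n / √(n : ℝ) :=
    fun n => div_nonneg vonMangoldt_nonneg (Real.sqrt_nonneg _)
  have e : charAvg q (Wosc q fhat) = -(1 / ((q : ℝ) - 2) * (1 / Real.log q) *
      ∑ n ∈ R, Λ n / √(n : ℝ) * fhat (Real.log n / Real.log q) *
        ∑ χ : DirichletCharacter ℂ q with χ ≠ 1, (χ n + (starRingEnd ℂ) (χ n)).re) := by
    rw [charAvg, sum_congr rfl fun χ _ => Wosc_eq_sum hsupp hq3 χ, ← mul_sum, sum_comm]
    simp only [← mul_sum]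
    rw [show ∀ a b c : ℝ, a * (-b * c) = -(a * b * c) by intros; ring]
    congr!
  have h1 : 0 < (q : ℝ) - 2 := by linarith
  have hT0 : 0 ≤ ∑ n ∈ R, Λ n / √(n : ℝ) := sum_nonneg fun n _ => hΛ n
  have hT1 : 0 ≤ ∑ n ∈ R with n ≡ 1 [MOD q], Λ n / √(n : ℝ) := sum_nonneg fun n _ => hΛ n
  rw [e, abs_neg, abs_mul, abs_of_pos (by positivity)]
  calc _ ≤ 1 / ((q : ℝ) - 2) * (1 / Real.log q) * ∑ n ∈ R, Λ n / √(n : ℝ) * M *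
        (2 * (if n ≡ 1 [MOD q] then ((q : ℝ) - 1) else 0) + 2) := by
        gcongr
        refine (abs_sum_le_sum_abs _ _).trans (sum_le_sum fun n _ => ?_)
        rw [abs_mul, abs_mul, abs_of_nonneg (hΛ n)]
        exact mul_le_mul (mul_le_mul_of_nonneg_left (hM _) (hΛ n))
          (charSum_re_nontrivial_abs_le n) (abs_nonneg _) (mul_nonneg (hΛ n) hM0)
    _ = M * (2 * (((q : ℝ) - 1) / (q - 2)) * ∑ n ∈ R with n ≡ 1 [MOD q], Λ n / √(n : ℝ) +
        2 / (q - 2) * ∑ n ∈ R, Λ n / √(n : ℝ)) / Real.log q := by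
        rw [sum_filter]
        have : ∑ n ∈ R, Λ n / √(n : ℝ) * M *
            (2 * (if n ≡ 1 [MOD q] then ((q : ℝ) - 1) else 0) + 2) =
            M * (2 * (q - 1) * (∑ n ∈ R, if n ≡ 1 [MOD q] then Λ n / √(n : ℝ) else 0) +
              2 * ∑ n ∈ R, Λ n / √(n : ℝ)) := by
          rw [mul_sum, mul_sum, ← sum_add_distrib, mul_sum]
          refine sum_congr rfl fun n _ => ?_
          split_ifs <;> ring
        rw [this]
        field_simp
    _ ≤ _ := by
        have h2 : ((q : ℝ) - 1) / (q - 2) ≤ 2 := by rw [div_le_iff₀ h1]; linarith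
        have h3 : 2 / ((q : ℝ) - 2) ≤ 6 / q := by
          rw [div_le_div_iff₀ h1 (by linarith)]; linarith
        gcongr
        linarith

theorem sum_vonMangoldt_progression_eq_zero {α : ℝ} (hα : α ≤ 1) {q : ℕ} (hq3 : 3 ≤ q) :
    ∑ n ∈ range (⌊(q : ℝ) ^ α⌋₊ + 1) with n ≡ 1 [MOD q], Λ n / √(n : ℝ) = 0 := by
  refine sum_eq_zero fun n hn => ?_
  simp only [mem_filter, mem_range] at hn
  have hnq : n ≤ q := by
    have h1 : (q : ℝ) ^ α ≤ q := by
      have : (1 : ℝ) ≤ q := by exact_mod_cast (by omega : 1 ≤ q)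
      simpa using Real.rpow_le_rpow_of_exponent_le this hα
    have h2 : ⌊(q : ℝ) ^ α⌋₊ ≤ q := by
      simpa using Nat.floor_le_floor h1
    omega
  have hmod := hn.2
  rcases hnq.eq_or_lt with h | h
  · subst h
    have := hmod.symm
    simp [Nat.ModEq, Nat.mod_eq_of_lt (show 1 < n by omega)] at this
  · have := Nat.ModEq.eq_of_lt_of_lt hmod h (by omega)
    simp [this]

theorem exists_sum_vonMangoldt_progression_le {α : ℝ} (hα2 : α ≤ 2) :
    ∃ C : ℝ, 0 ≤ C ∧ ∀ q : ℕ, q.Prime → 3 ≤ q →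
      ∑ n ∈ range (⌊(q : ℝ) ^ α⌋₊ + 1) with n ≡ 1 [MOD q], Λ n / √(n : ℝ) ≤
        C * (q : ℝ) ^ (α / 2 - 1) := by
  rcases le_or_gt α 1 with h | h
  · refine ⟨0, le_rfl, fun q _ hq3 => ?_⟩
    rw [sum_vonMangoldt_progression_eq_zero h hq3, zero_mul]
  · have : 0 < α - 1 := by linarith
    exact ⟨_, by positivity, fun q hq hq3 => sum_vonMangoldt_progression_floor_le h hα2 hq hq3⟩

end Auxiliary

/-- If `f` is real and even with `f̂` continuous and supported in `[-α, α]`, `0 < α ≤ 2`,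
then `⟨W_f^osc⟩_q ≪ q^{α/2-1}/log q`; in particular it is `O(1/log q)` and tends to `0`
as `q → ∞` through (odd) primes. -/
theorem charAvg_Wosc_bound (f fhat : ℝ → ℝ) (heven : ∀ x, f (-x) = f x)
    (hcont : Continuous fhat) (α : ℝ) (hα : 0 < α) (hα2 : α ≤ 2)
    (hsupp : Function.support fhat ⊆ Set.Icc (-α) α)
    (hfourier : ∀ u : ℝ, (fhat u : ℂ) =
      ∫ x : ℝ, (f x : ℂ) * Complex.exp (-(2 * Real.pi * Complex.I) * x * u)) :
    ∃ C : ℝ,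
      (∀ q : ℕ, q.Prime → Odd q →
        |charAvg q (Wosc q fhat)| ≤ C * (q : ℝ) ^ (α / 2 - 1) / Real.log q) ∧
      Tendsto (fun q : ℕ => charAvg q (Wosc q fhat))
        (atTop ⊓ Filter.principal {q : ℕ | q.Prime ∧ Odd q}) (nhds 0) := by
  obtain ⟨M, hM⟩ : ∃ M, ∀ u, |fhat u| ≤ M :=
    (HasCompactSupport.intro isCompact_Icc fun u hu => by
      by_contra h
      exact hu (hsupp h)).exists_bound_of_continuous hcont
  have hM0 : 0 ≤ M := (abs_nonneg _).trans (hM 0)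
  obtain ⟨C₁, hC₁, hprog⟩ := exists_sum_vonMangoldt_progression_le hα2
  have hlog4 : 0 ≤ Real.log 4 := Real.log_nonneg (by norm_num)
  have hbound : ∀ q : ℕ, q.Prime → Odd q → |charAvg q (Wosc q fhat)| ≤
      M * (4 * C₁ + 12 * (Real.log 4 + 4)) * (q : ℝ) ^ (α / 2 - 1) / Real.log q := by
    intro q hq hodd
    have hq3 : 3 ≤ q := by
      have := hq.two_le
      rcases hodd with ⟨k, rfl⟩
      omega
    have hq0 : (0 : ℝ) < q := by positivity
    have hL := one_le_log_natCast hq3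
    refine (abs_charAvg_Wosc_le hsupp hM hq hq3).trans ?_
    have h1 := hprog q hq hq3
    have h2 : ∑ n ∈ Finset.range (⌊(q : ℝ) ^ α⌋₊ + 1), Λ n / √(n : ℝ) ≤
        2 * (Real.log 4 + 4) * (q : ℝ) ^ (α / 2) := by
      refine (sum_vonMangoldt_div_sqrt_le _).trans ?_
      gcongr
      calc √((⌊(q : ℝ) ^ α⌋₊ : ℕ) : ℝ) ≤ √((q : ℝ) ^ α) :=
            Real.sqrt_le_sqrt (Nat.floor_le (by positivity))
        _ = _ := by rw [Real.sqrt_eq_rpow, ← Real.rpow_mul hq0.le]; congr 1; ring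
    have h3 : (q : ℝ) ^ (α / 2) = (q : ℝ) ^ (α / 2 - 1) * q := by
      rw [← Real.rpow_add_one hq0.ne']; simp
    rw [h3] at h2
    calc _ ≤ M * (4 * (C₁ * (q : ℝ) ^ (α / 2 - 1)) +
          6 / q * (2 * (Real.log 4 + 4) * ((q : ℝ) ^ (α / 2 - 1) * q))) / Real.log q := by
          gcongr
      _ = _ := by field_simp; ring
  refine ⟨_, hbound, ?_⟩
  set C := M * (4 * C₁ + 12 * (Real.log 4 + 4))
  have hC : 0 ≤ C := by positivity
  have hlim : Tendsto (fun q : ℕ => C / Real.log q) atTop (nhds 0) :=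
    (Real.tendsto_log_atTop.comp tendsto_natCast_atTop_atTop).const_div_atTop C
  refine squeeze_zero_norm' ?_ (hlim.mono_left inf_le_left)
  rw [eventually_inf_principal]
  refine Eventually.of_forall fun q hq => (hbound q hq.1 hq.2).trans ?_
  have hq1 : (1 : ℝ) ≤ q := by exact_mod_cast hq.1.one_le
  have hp : (q : ℝ) ^ (α / 2 - 1) ≤ 1 := Real.rpow_le_one_of_one_le_of_nonpos hq1 (by linarith)
  exact div_le_div_of_nonneg_right (mul_le_of_le_one_right hC hp) (Real.log_natCast_nonneg q)
end

section
/- There is an absolute constant C such that for every odd prime q ≥ 3, Σ 1/√(p · p̄) ≤ C/√(log q), where the sum runs over all primes p with 1 < p < q such that p̄ is also prime, and p̄ denotes the unique integer in [1, q−1] with p·p̄ ≡ 1 (mod q). -/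
theorem sum_Icc_inv_sqrt_le (n : ℕ) :
    ∑ k ∈ Finset.Icc 1 n, 1 / Real.sqrt k ≤ 2 * Real.sqrt n := by
  induction n with
  | zero => simp
  | succ n ih =>
    rw [Finset.sum_Icc_succ_top (by omega)]
    have hb : 0 < Real.sqrt ((n + 1 : ℕ) : ℝ) := Real.sqrt_pos.2 (by positivity)
    have ha : 0 ≤ Real.sqrt (n : ℝ) := Real.sqrt_nonneg _
    have ha2 : Real.sqrt (n : ℝ) ^ 2 = n := Real.sq_sqrt (by positivity)
    have hb2 : Real.sqrt ((n + 1 : ℕ) : ℝ) ^ 2 = n + 1 := by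
      rw [Real.sq_sqrt (by positivity)]; push_cast; rfl
    have key : 1 / Real.sqrt ((n + 1 : ℕ) : ℝ) ≤
        2 * Real.sqrt ((n + 1 : ℕ) : ℝ) - 2 * Real.sqrt (n : ℝ) := by
      rw [div_le_iff₀ hb]
      nlinarith [sq_nonneg (Real.sqrt ((n + 1 : ℕ) : ℝ) - Real.sqrt (n : ℝ))]
    linarith

/-- If `k` takes positive values on `S` and is at most two-to-one there, then splitting at a
threshold `T` bounds the sum of `1/√(k p)`. -/
theorem sum_inv_sqrt_le_of_card_fiber_le_two (S : Finset ℕ) (k : ℕ → ℕ)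
    (hpos : ∀ p ∈ S, 1 ≤ k p) (hfib : ∀ p ∈ S, (S.filter fun r => k r = k p).card ≤ 2)
    {T : ℝ} (hT : 0 < T) :
    ∑ p ∈ S, 1 / Real.sqrt (k p) ≤ 4 * Real.sqrt T + S.card / Real.sqrt T := by
  have hsT : 0 < Real.sqrt T := Real.sqrt_pos.2 hT
  rw [← Finset.sum_filter_add_sum_filter_not S (fun p => k p ≤ ⌊T⌋₊)]
  refine add_le_add ?_ ?_
  · rw [Finset.sum_comp (fun n : ℕ => 1 / Real.sqrt (n : ℝ)) k]
    calc _ ≤ ∑ n ∈ (S.filter fun p => k p ≤ ⌊T⌋₊).image k, 2 * (1 / Real.sqrt (n : ℝ)) := by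
          refine Finset.sum_le_sum fun n hn => ?_
          obtain ⟨p, hp, rfl⟩ := Finset.mem_image.1 hn
          rw [nsmul_eq_mul]
          refine mul_le_mul_of_nonneg_right ?_ (by positivity)
          have := (Finset.card_le_card (Finset.filter_subset_filter (fun r => k r = k p)
            (Finset.filter_subset (fun p => k p ≤ ⌊T⌋₊) S))).trans
            (hfib p (Finset.mem_filter.1 hp).1)
          exact_mod_cast this
      _ ≤ ∑ n ∈ Finset.Icc 1 ⌊T⌋₊, 2 * (1 / Real.sqrt (n : ℝ)) := by
          refine Finset.sum_le_sum_of_subset_of_nonneg (fun n hn => ?_)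
            fun _ _ _ => by positivity
          obtain ⟨p, hp, rfl⟩ := Finset.mem_image.1 hn
          rw [Finset.mem_filter] at hp
          exact Finset.mem_Icc.2 ⟨hpos p hp.1, hp.2⟩
      _ ≤ 2 * (2 * Real.sqrt ⌊T⌋₊) := by
          rw [← Finset.mul_sum]
          exact mul_le_mul_of_nonneg_left (sum_Icc_inv_sqrt_le _) (by norm_num)
      _ ≤ 4 * Real.sqrt T := by
          have := Real.sqrt_le_sqrt (Nat.floor_le hT.le)
          linarith
  · calc _ ≤ ∑ p ∈ S.filter (fun p => ¬ k p ≤ ⌊T⌋₊), 1 / Real.sqrt T := by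
          refine Finset.sum_le_sum fun p hp => ?_
          have h := (Nat.lt_of_floor_lt (not_le.1 (Finset.mem_filter.1 hp).2)).le
          exact one_div_le_one_div_of_le hsT (Real.sqrt_le_sqrt h)
      _ ≤ S.card / Real.sqrt T := by
          rw [Finset.sum_const, nsmul_eq_mul, mul_one_div]
          have : ((S.filter (fun p => ¬ k p ≤ ⌊T⌋₊)).card : ℝ) ≤ S.card := by
            exact_mod_cast Finset.card_filter_le _ _
          gcongr

theorem primeCounting_le_mul_div_log {n : ℕ} (hn : 1 < n) :
    (Nat.primeCounting n : ℝ) ≤ (2 * Real.log 4 + 2) * (n / Real.log n) := by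
  have hn' : (1 : ℝ) < n := by exact_mod_cast hn
  have hL : 0 < Real.log n := Real.log_pos hn'
  have h := Chebyshev.pi_le_log4_mul_div hn'
  rw [Nat.floor_natCast, Real.log_sqrt (by positivity)] at h
  have hs : Real.sqrt n ≤ 2 * (n / Real.log n) := by
    have h1 := Real.log_le_self (Real.sqrt_nonneg (n : ℝ))
    rw [Real.log_sqrt (by positivity)] at h1
    have h2 : Real.sqrt (n : ℝ) ^ 2 = n := Real.sq_sqrt (by positivity)
    rw [← mul_div_assoc, le_div_iff₀ hL]
    nlinarith [Real.sqrt_nonneg (n : ℝ)]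
  have e : Real.log 4 * n / (Real.log n / 2) = 2 * Real.log 4 * (n / Real.log n) := by
    field_simp
  rw [e] at h
  linarith

theorem natCast_mul_inv_val_mod {q p : ℕ} (hq : q.Prime) (hp0 : 0 < p) (hpq : p < q) :
    p * ((p : ZMod q)⁻¹.val) % q = 1 := by
  have := Fact.mk hq
  have hne : (p : ZMod q) ≠ 0 := by
    rw [Ne, ZMod.natCast_eq_zero_iff]
    exact Nat.not_dvd_of_pos_of_lt hp0 hpq
  have h : ((p * ((p : ZMod q)⁻¹.val) : ℕ) : ZMod q) = (1 : ℕ) := by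
    push_cast
    rw [ZMod.natCast_zmod_val, mul_inv_cancel₀ hne]
  rw [ZMod.natCast_eq_natCast_iff] at h
  rw [h, Nat.mod_eq_of_lt hq.one_lt]

open scoped Classical in
/-- The sum of `1/√(p·p̄)` over primes `p` with `1 < p < q` whose inverse `p̄` modulo `q`
(the unique representative in `[1, q-1]`) is also prime is `O(1/√(log q))`. -/
theorem sum_inv_sqrt_prime_inverse_pairs :
    ∃ C : ℝ, ∀ q : ℕ, q.Prime → Odd q →
      ∑ p ∈ Finset.range q,
        (if 1 < p ∧ p.Prime ∧ Nat.Prime ((p : ZMod q)⁻¹.val)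
          then 1 / Real.sqrt (p * ((p : ZMod q)⁻¹.val)) else 0) ≤
      C / Real.sqrt (Real.log q) := by
  refine ⟨4 + (2 * Real.log 4 + 2), fun q hq _ => ?_⟩
  have hq1 : (1 : ℝ) < q := by exact_mod_cast hq.one_lt
  have hL : 0 < Real.log q := Real.log_pos hq1
  rw [← Finset.sum_filter]
  set S := (Finset.range q).filter
    (fun p : ℕ => 1 < p ∧ p.Prime ∧ Nat.Prime ((p : ZMod q)⁻¹.val)) with hS
  set k : ℕ → ℕ := fun p => p * ((p : ZMod q)⁻¹.val) / q with hk
  have hmem : ∀ p ∈ S, p < q ∧ p.Prime ∧ Nat.Prime ((p : ZMod q)⁻¹.val) := fun p hp => by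
    rw [hS, Finset.mem_filter, Finset.mem_range] at hp
    exact ⟨hp.1, hp.2.2⟩
  have hdiv : ∀ p ∈ S, q * k p + 1 = p * ((p : ZMod q)⁻¹.val) := fun p hp => by
    have h := Nat.div_add_mod (p * ((p : ZMod q)⁻¹.val)) q
    rwa [natCast_mul_inv_val_mod hq (hmem p hp).2.1.pos (hmem p hp).1] at h
  have hpos : ∀ p ∈ S, 1 ≤ k p := fun p hp => by
    have h := hdiv p hp
    have h2 := Nat.mul_le_mul (hmem p hp).2.1.two_le (hmem p hp).2.2.two_le
    by_contra! h0
    rw [Nat.lt_one_iff.1 h0] at h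
    omega
  have hfib : ∀ p ∈ S, (S.filter fun r => k r = k p).card ≤ 2 := fun p hp => by
    refine (Finset.card_le_card (t := {p, (p : ZMod q)⁻¹.val}) fun r hr => ?_).trans
      Finset.card_le_two
    obtain ⟨hr, hrk⟩ := Finset.mem_filter.1 hr
    have h : p * ((p : ZMod q)⁻¹.val) = r * ((r : ZMod q)⁻¹.val) := by
      rw [← hdiv p hp, ← hdiv r hr, hrk]
    have hd : r ∣ p * ((p : ZMod q)⁻¹.val) := h ▸ dvd_mul_right _ _
    obtain ⟨-, hpp, hpi⟩ := hmem p hp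
    have hrp := (hmem r hr).2.1
    rw [Finset.mem_insert, Finset.mem_singleton]
    exact (hrp.dvd_mul.1 hd).imp (Nat.prime_dvd_prime_iff_eq hrp hpp).1
      (Nat.prime_dvd_prime_iff_eq hrp hpi).1
  have hcard : (S.card : ℝ) ≤ (2 * Real.log 4 + 2) * (q / Real.log q) := by
    refine le_trans ?_ (primeCounting_le_mul_div_log hq.one_lt)
    rw [Nat.primeCounting, Nat.primeCounting', Nat.count_eq_card_filter_range]
    refine Nat.cast_le.2 (Finset.card_le_card fun p hp => ?_)
    have := hmem p hp
    exact Finset.mem_filter.2 ⟨Finset.mem_range.2 (by omega), this.2.1⟩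
  have hT : 0 < (q : ℝ) / Real.log q := by positivity
  have hmain := sum_inv_sqrt_le_of_card_fiber_le_two S k hpos hfib hT
  set t := Real.sqrt ((q : ℝ) / Real.log q) with ht
  have ht0 : 0 < t := Real.sqrt_pos.2 hT
  have htT : (q : ℝ) / Real.log q = t * t := (Real.mul_self_sqrt hT.le).symm
  have hsq : 0 < Real.sqrt (q : ℝ) := Real.sqrt_pos.2 (by positivity)
  have hcard' : (S.card : ℝ) / t ≤ (2 * Real.log 4 + 2) * t := by
    rw [div_le_iff₀ ht0, mul_assoc, ← htT]
    exact hcard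
  calc ∑ p ∈ S, 1 / Real.sqrt (p * ((p : ZMod q)⁻¹.val))
      ≤ ∑ p ∈ S, 1 / Real.sqrt q * (1 / Real.sqrt (k p)) := by
        refine Finset.sum_le_sum fun p hp => ?_
        have hk0 : (0 : ℝ) < k p := by exact_mod_cast hpos p hp
        rw [one_div_mul_one_div, ← Real.sqrt_mul (by positivity)]
        refine one_div_le_one_div_of_le (Real.sqrt_pos.2 (by positivity)) (Real.sqrt_le_sqrt ?_)
        have h := hdiv p hp
        have h' : q * k p ≤ p * ((p : ZMod q)⁻¹.val) := by omega
        exact_mod_cast h'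
    _ ≤ 1 / Real.sqrt q * ((4 + (2 * Real.log 4 + 2)) * t) := by
        rw [← Finset.mul_sum]
        refine mul_le_mul_of_nonneg_left ?_ (by positivity)
        linarith
    _ = (4 + (2 * Real.log 4 + 2)) / Real.sqrt (Real.log q) := by
        rw [ht, Real.sqrt_div (by positivity)]
        field_simp
end
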